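/- Let λ : ℂ∖{0} → ℝ be a harmonic function for which there exists a constant C > 0 with |∇λ(x)| ≤ C/|x| for all x ∈ ℂ∖{0}. Then there exist constants β, c ∈ ℝ such that λ(z) = β·log|z| + c for all z ∈ ℂ∖{0}. -/

import Mathlib

noncomputable section

open Filter Topology Set

/-- The flat Laplacian of `f : ℂ → ℝ`, as the sum of the repeated directional derivatives
in the directions `1` and `I`. -/
def lap (f : ℂ → ℝ) (z : ℂ) : ℝ :=
  fderiv ℝ (fun w => fderiv ℝ f w 1) z 1 +
    fderiv ℝ (fun w => fderiv ℝ f w Complex.I) z Complex.I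

open Complex InnerProductSpace in
/-- A `C²` function on an open set with vanishing `lap` is harmonic there. -/
lemma harmonicAt_of_lap_eq_zero {f : ℂ → ℝ} {s : Set ℂ} (hs : IsOpen s)
    (hf : ContDiffOn ℝ 2 f s) (hlap : ∀ z ∈ s, lap f z = 0) {z : ℂ} (hz : z ∈ s) :
    HarmonicAt f z := by
  refine ⟨hf.contDiffAt (hs.mem_nhds hz), ?_⟩
  filter_upwards [hs.mem_nhds hz] with w hw
  have hd : DifferentiableAt ℝ (fderiv ℝ f) w :=
    ((hf.contDiffAt (hs.mem_nhds hw)).fderiv_right (m := 1) (by norm_num)).differentiableAt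
      one_ne_zero
  have h := hlap w hw
  rw [lap, fderiv_clm_apply hd (by fun_prop), fderiv_clm_apply hd (by fun_prop)] at h
  simpa [laplacian_eq_iteratedFDeriv_complexPlane, iteratedFDeriv_two_apply] using h

/-- A holomorphic function on the punctured plane that is `O(1 / |z|)` is a multiple of `1 / z`. -/
lemma exists_mul_eq_const_of_norm_le_div {g : ℂ → ℂ} {K : ℝ}
    (hg : ∀ z : ℂ, z ≠ 0 → DifferentiableAt ℂ g z) (hK : ∀ z : ℂ, z ≠ 0 → ‖g z‖ ≤ K / ‖z‖) :
    ∃ a : ℂ, ∀ z : ℂ, z ≠ 0 → g z * z = a := by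
  have hbound : ∀ z : ℂ, z ≠ 0 → ‖g z * z‖ ≤ K := fun z hz => by
    rw [norm_mul]
    exact (le_div_iff₀ (norm_pos_iff.2 hz)).1 (hK z hz)
  set G : ℂ → ℂ := Function.update (fun z => g z * z) 0 (limUnder (𝓝[≠] 0) fun z => g z * z)
    with hG
  have hGz : ∀ z : ℂ, z ≠ 0 → G z = g z * z := fun z hz => by simp [hG, hz]
  have hGdiff : Differentiable ℂ G := by
    rw [← differentiableOn_univ]
    refine Complex.differentiableOn_update_limUnder_of_bddAbove univ_mem
      (fun z hz => ((hg z hz.2).mul differentiableAt_id).differentiableWithinAt) ⟨K, ?_⟩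
    rintro _ ⟨z, hz, rfl⟩
    exact hbound z hz.2
  have hGbdd : Bornology.IsBounded (range G) := by
    refine isBounded_iff_forall_norm_le.2 ⟨max K ‖G 0‖, ?_⟩
    rintro _ ⟨z, rfl⟩
    by_cases hz : z = 0
    · exact hz ▸ le_max_right _ _
    · exact (hGz z hz ▸ hbound z hz).trans (le_max_left _ _)
  exact ⟨G 0, fun z hz => hGz z hz ▸ hGdiff.apply_eq_apply_of_bounded hGbdd z 0⟩

/-- A real linear functional on `ℂ` is the real part of multiplication by a complex number. -/
lemma clm_apply_eq_re_mul (L : ℂ →L[ℝ] ℝ) (v : ℂ) :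
    L v = (((L 1 : ℂ) - Complex.I * L Complex.I) * v).re := by
  have hv : v = v.re • (1 : ℂ) + v.im • Complex.I := by simp
  conv_lhs => rw [hv, map_add, map_smul, map_smul]
  simp
  ring

/-- harmonic functions on the punctured plane with `C/|z|` gradient
bound are logarithms.  If `λ` is harmonic on `ℂ ∖ {0}` (twice continuously
differentiable with vanishing Laplacian) and `|∇λ(x)| ≤ C/|x|` for all `x ≠ 0`, then
`λ(z) = β·log|z| + c` on `ℂ ∖ {0}` for some constants `β, c ∈ ℝ`. -/
theorem harmonic_with_inverse_gradient_bound_is_log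
    (lam : ℂ → ℝ)
    (hC2 : ContDiffOn ℝ 2 lam {(0 : ℂ)}ᶜ)
    (hharm : ∀ z : ℂ, z ≠ 0 → lap lam z = 0)
    (C : ℝ) (hC : 0 < C)
    (hgrad : ∀ z : ℂ, z ≠ 0 → ‖fderiv ℝ lam z‖ ≤ C / ‖z‖) :
    ∃ β c : ℝ, ∀ z : ℂ, z ≠ 0 → lam z = β * Real.log ‖z‖ + c := by
  have hne : IsOpen ({(0 : ℂ)}ᶜ : Set ℂ) := isOpen_compl_singleton
  obtain ⟨a, ha⟩ := exists_mul_eq_const_of_norm_le_div (K := 2 * C)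
    (fun z hz =>
      HarmonicAt.differentiableAt_complex_partial (harmonicAt_of_lap_eq_zero hne hC2 hharm hz))
    (fun z hz => by
      have h1 := (fderiv ℝ lam z).le_opNorm 1
      have h2 := (fderiv ℝ lam z).le_opNorm Complex.I
      have h3 := norm_sub_le (fderiv ℝ lam z 1 : ℂ) (Complex.I * fderiv ℝ lam z Complex.I)
      simp only [norm_mul, Complex.norm_real, Complex.norm_I, norm_one, one_mul, mul_one]
        at h1 h2 h3
      have h4 := hgrad z hz
      rw [mul_div_assoc]
      linarith)
  have hderiv : ∀ w : ℂ,
      HasFDerivAt (fun w => lam (Complex.exp w) - (a * w).re) (0 : ℂ →L[ℝ] ℝ) w := by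
    intro w
    have hw := Complex.exp_ne_zero w
    have h1 : HasFDerivAt lam (fderiv ℝ lam (Complex.exp w)) (Complex.exp w) :=
      ((hC2.contDiffAt (hne.mem_nhds hw)).differentiableAt two_ne_zero).hasFDerivAt
    have h2 := (Complex.hasDerivAt_exp w).hasFDerivAt.restrictScalars ℝ
    have h3 := ((hasDerivAt_id w).const_mul a).hasFDerivAt.restrictScalars ℝ
    refine ((h1.comp w h2).sub (Complex.reCLM.hasFDerivAt.comp w h3)).congr_fderiv ?_
    ext v
    have h := clm_apply_eq_re_mul (fderiv ℝ lam (Complex.exp w)) (v * Complex.exp w)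
    rw [mul_left_comm, ha _ hw] at h
    simp [h, -map_mul, -Complex.mul_re]
  obtain ⟨c, hc⟩ : ∃ c, ∀ w : ℂ, lam (Complex.exp w) = (a * w).re + c :=
    ⟨_, fun w => sub_eq_iff_eq_add'.1 <| is_const_of_fderiv_eq_zero (𝕜 := ℝ)
      (fun w => (hderiv w).differentiableAt) (fun w => (hderiv w).fderiv) w 0⟩
  have him : a.im = 0 := by
    have h0 := hc 0
    have h1 := hc (2 * Real.pi * Complex.I)
    rw [Complex.exp_two_pi_mul_I, ← Complex.exp_zero, h0] at h1
    simpa [Real.pi_ne_zero] using h1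
  refine ⟨a.re, c, fun z hz => ?_⟩
  have h := hc (Complex.log z)
  rwa [Complex.exp_log hz, Complex.mul_re, him, zero_mul, sub_zero, Complex.log_re] at h
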